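/- arXiv:2108.08293 — 2 statements merged into one kernel-verified Lean document; each statement's English description precedes it below -/
import Mathlib

section
/- Any two quadrilaterals are pedal equivalent: if V = (V_1,V_2,V_3,V_4) and W = (W_1,W_2,W_3,W_4) are 4-gons in ℝ² such that in each of V and W no three successive vertices are collinear and the opposite vertices are distinct (V_1 ≠ V_3, V_2 ≠ V_4, W_1 ≠ W_3, W_2 ≠ W_4), then V ⊥ W. Consequently the quotient of this set of quadrilaterals by the relation ⊥ has exactly one element. -/
open scoped InnerProductSpace

noncomputable section

/-- The Euclidean plane. -/
abbrev Plane := EuclideanSpace ℝ (Fin 2)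

/-- The foot of the perpendicular from `X` to the line through `A` and `B`
(the orthogonal projection of `X` onto that line, when `A ≠ B`). -/
noncomputable def foot (A B X : Plane) : Plane :=
  A + (⟪X - A, B - A⟫_ℝ / ⟪B - A, B - A⟫_ℝ) • (B - A)

/-- The pedal polygon of the `n`-gon `V` with respect to the point `X`:
its `i`-th vertex is the orthogonal projection of `X` onto the line through
`V i` and `V (i+1)` (indices mod `n`). -/
noncomputable def pedal {n : ℕ} (V : ZMod n → Plane) (X : Plane) : ZMod n → Plane :=
  fun i => foot (V i) (V (i + 1)) X

/-- No three successive vertices of the `n`-gon `V` are collinear. -/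
def NoThreeCollinear {n : ℕ} (V : ZMod n → Plane) : Prop :=
  ∀ i : ZMod n, ¬ Collinear ℝ ({V i, V (i + 1), V (i + 2)} : Set Plane)

/-- Two `n`-gons are similar: there are `k > 0` and a bijection `τ` of `ZMod n` of the
form `τ i = c + i` or `τ i = c - i` such that `dist (P (τ i)) (P (τ j)) = k * dist (W i) (W j)`. -/
def SimilarGon {n : ℕ} (P W : ZMod n → Plane) : Prop :=
  ∃ k : ℝ, 0 < k ∧ ∃ c : ZMod n,
    ((∀ i j : ZMod n, dist (P (c + i)) (P (c + j)) = k * dist (W i) (W j)) ∨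
     (∀ i j : ZMod n, dist (P (c - i)) (P (c - j)) = k * dist (W i) (W j)))

/-- The sequence of iterated pedal polygons of `V` with respect to the points
`X 1, X 2, …` : `pedalSeq V X 0 = V` and `pedalSeq V X k = pedal (pedalSeq V X (k-1)) (X k)`. -/
noncomputable def pedalSeq {n : ℕ} (V : ZMod n → Plane) (X : ℕ → Plane) : ℕ → ZMod n → Plane
  | 0 => V
  | k + 1 => pedal (pedalSeq V X k) (X (k + 1))

/-- `V` and `W` are pedal equivalent (`V ⊥ W`): some iterated pedal polygon of `V`
(all of whose stages have no three successive vertices collinear) is similar to `W`. -/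
def PedalEquiv {n : ℕ} (V W : ZMod n → Plane) : Prop :=
  ∃ m : ℕ, 1 ≤ m ∧ ∃ X : ℕ → Plane,
    (∀ k : ℕ, 1 ≤ k → k ≤ m → NoThreeCollinear (pedalSeq V X k)) ∧
    SimilarGon (pedalSeq V X m) W

/-- The set of quadrilaterals with no three successive vertices collinear and with
distinct opposite vertices. -/
def Quad4 : Type :=
  {U : ZMod 4 → Plane // NoThreeCollinear U ∧ U 0 ≠ U 2 ∧ U 1 ≠ U 3}

open ComplexConjugate

/-- The planar cross product of two complex numbers. -/
def cross (z w : ℂ) : ℝ := z.re * w.im - z.im * w.re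

/-- The real scalar product of two complex numbers. -/
def dot (z w : ℂ) : ℝ := z.re * w.re + z.im * w.im

/-- The orthogonal projection of `X` onto the line through `A` and `B` in the complex plane. -/
def cfoot (A B X : ℂ) : ℂ := A + ((dot (X - A) (B - A) / dot (B - A) (B - A) : ℝ) : ℂ) * (B - A)

/-- The quadrilateral with the given vertices. -/
def quad (a b c d : ℂ) : ZMod 4 → ℂ := (![a, b, c, d] : Fin 4 → ℂ)

@[simp] lemma quad_zero (a b c d : ℂ) : quad a b c d 0 = a := rfl
@[simp] lemma quad_one (a b c d : ℂ) : quad a b c d 1 = b := rfl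
@[simp] lemma quad_two (a b c d : ℂ) : quad a b c d 2 = c := rfl
@[simp] lemma quad_three (a b c d : ℂ) : quad a b c d 3 = d := rfl

lemma forall_zmod_four {p : ZMod 4 → Prop} : (∀ i, p i) ↔ p 0 ∧ p 1 ∧ p 2 ∧ p 3 :=
  ⟨fun h => ⟨h 0, h 1, h 2, h 3⟩, fun ⟨h0, h1, h2, h3⟩ i => by fin_cases i <;> assumption⟩

/-- No three successive vertices are collinear, expressed by cross products of side vectors. -/
def Nondeg (V : ZMod 4 → ℂ) : Prop :=
  cross (V 1 - V 0) (V 2 - V 1) ≠ 0 ∧ cross (V 2 - V 1) (V 3 - V 2) ≠ 0 ∧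
  cross (V 3 - V 2) (V 0 - V 3) ≠ 0 ∧ cross (V 0 - V 3) (V 1 - V 0) ≠ 0

/-- `W` is a nondegenerate pedal quadrilateral of `V`, up to a direct similarity. -/
def Step (V W : ZMod 4 → ℂ) : Prop :=
  Nondeg W ∧ ∃ X l m : ℂ, l ≠ 0 ∧ ∀ i, cfoot (V i) (V (i + 1)) X = l * W i + m

lemma dot_self_pos {z : ℂ} (hz : z ≠ 0) : 0 < dot z z := by
  have : dot z z = Complex.normSq z := by simp [dot, Complex.normSq_apply]
  rw [this]; exact Complex.normSq_pos.2 hz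

lemma ne_zero_left_of_cross {z w : ℂ} (h : cross z w ≠ 0) : z ≠ 0 := by
  rintro rfl; simp [cross] at h

lemma ne_zero_right_of_cross {z w : ℂ} (h : cross z w ≠ 0) : w ≠ 0 := by
  rintro rfl; simp [cross] at h

lemma Nondeg.sides_ne {V : ZMod 4 → ℂ} (h : Nondeg V) :
    V 0 ≠ V 1 ∧ V 1 ≠ V 2 ∧ V 2 ≠ V 3 ∧ V 3 ≠ V 0 :=
  ⟨(sub_ne_zero.1 (ne_zero_left_of_cross h.1)).symm,
    (sub_ne_zero.1 (ne_zero_left_of_cross h.2.1)).symm,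
    (sub_ne_zero.1 (ne_zero_left_of_cross h.2.2.1)).symm,
    (sub_ne_zero.1 (ne_zero_left_of_cross h.2.2.2)).symm⟩

lemma Nondeg.diagonal_ne {V : ZMod 4 → ℂ} (h : Nondeg V) : V 0 ≠ V 2 := by
  intro e
  apply h.1
  rw [← e]; simp only [cross, Complex.sub_re, Complex.sub_im]; ring

/-- The square of the unit direction of the line through `A` and `B`. -/
def wdir (A B : ℂ) : ℂ := (B - A) / conj (B - A)

lemma conj_sub_ne_zero {A B : ℂ} (h : A ≠ B) : conj (B - A) ≠ 0 := by
  rw [Ne, map_eq_zero]; exact sub_ne_zero.2 h.symm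

lemma ofReal_dot (z w : ℂ) : ((dot z w : ℝ) : ℂ) = (z * conj w + conj z * w) / 2 := by
  apply Complex.ext
  · simp [dot]
  · simp [dot]; ring

lemma ofReal_cross (z w : ℂ) :
    ((cross z w : ℝ) : ℂ) = Complex.I * (z * conj w - conj z * w) / 2 := by
  apply Complex.ext
  · simp [cross]; ring
  · simp [cross]

lemma cfoot_eq_start {A B : ℂ} (h : A ≠ B) (X : ℂ) :
    cfoot A B X = A + ((X - A) + wdir A B * conj (X - A)) / 2 := by
  have h1 := conj_sub_ne_zero h
  have h2 : B - A ≠ 0 := sub_ne_zero.2 h.symm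
  unfold cfoot wdir
  rw [Complex.ofReal_div, ofReal_dot, ofReal_dot]
  generalize B - A = d at *
  generalize conj d = e at *
  generalize X - A = z at *
  field_simp
  ring

lemma cfoot_eq_end {A B : ℂ} (h : A ≠ B) (X : ℂ) :
    cfoot A B X = B + ((X - B) + wdir A B * conj (X - B)) / 2 := by
  have h1 := conj_sub_ne_zero h
  rw [cfoot_eq_start h]
  unfold wdir
  field_simp
  simp only [map_sub]
  ring

lemma cfoot_sub_cfoot {A B C : ℂ} (h : A ≠ B) (h' : B ≠ C) (X : ℂ) :
    cfoot A B X - cfoot B C X = (wdir A B - wdir B C) * conj (X - B) / 2 := by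
  rw [cfoot_eq_end h, cfoot_eq_start h']; ring

lemma wdir_sub_wdir {A B C D : ℂ} (h : A ≠ B) (h' : C ≠ D) :
    wdir A B - wdir C D =
      -2 * Complex.I * cross (B - A) (D - C) / (conj (B - A) * conj (D - C)) := by
  have h1 := conj_sub_ne_zero h
  have h2 := conj_sub_ne_zero h'
  unfold wdir
  rw [ofReal_cross]
  generalize conj (B - A) = p at *
  generalize conj (D - C) = q at *
  field_simp
  linear_combination ((B-A)*q-(D-C)*p) * Complex.I_sq

lemma wdir_ne {A B C D : ℂ} (h : cross (B - A) (D - C) ≠ 0) : wdir A B - wdir C D ≠ 0 := by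
  have hA : A ≠ B := (sub_ne_zero.1 (ne_zero_left_of_cross h)).symm
  have hC : C ≠ D := (sub_ne_zero.1 (ne_zero_right_of_cross h)).symm
  rw [wdir_sub_wdir hA hC]
  have h1 := conj_sub_ne_zero hA
  have h2 := conj_sub_ne_zero hC
  have : ((cross (B - A) (D - C) : ℝ) : ℂ) ≠ 0 := by exact_mod_cast h
  simp only [ne_eq, div_eq_zero_iff, mul_eq_zero, Complex.I_ne_zero, this, h1, h2]
  norm_num

lemma wdir_mul_conj {A B : ℂ} (h : A ≠ B) : wdir A B * conj (wdir A B) = 1 := by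
  have h1 := conj_sub_ne_zero h
  have h2 : B - A ≠ 0 := sub_ne_zero.2 h.symm
  unfold wdir
  rw [map_div₀, Complex.conj_conj]
  field_simp

lemma cfoot_eq_of {A B X P : ℂ} (h : A ≠ B) (hc : cross (P - A) (B - A) = 0)
    (hd : dot (P - X) (B - A) = 0) : cfoot A B X = P := by
  have h1 := conj_sub_ne_zero h
  rw [cfoot_eq_start h]
  have e1 := ofReal_cross (P - A) (B - A)
  have e2 := ofReal_dot (P - X) (B - A)
  rw [hc] at e1; rw [hd] at e2
  have e1' : (P - A) * conj (B - A) - conj (P - A) * (B - A) = 0 := by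
    have : Complex.I * ((P - A) * conj (B - A) - conj (P - A) * (B - A)) = 0 := by
      rw [Complex.ofReal_zero] at e1; linear_combination -2 * e1
    simpa using this
  unfold wdir
  field_simp
  simp only [map_sub] at *
  rw [Complex.ofReal_zero] at e2
  linear_combination (-1) * e1' + 2 * e2

/-- Parallelograms reach every quadrilateral whose diagonals fit. -/
lemma step_of_parallelogram {Z W : ZMod 4 → ℂ} {σ : ℂ} (hσ : σ.im ≠ 0)
    (hp : Z 0 - Z 1 = Z 3 - Z 2) (hF : Z 1 - Z 2 ≠ 0)
    (hE : conj (Z 0 - Z 1) = σ * conj (Z 1 - Z 2))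
    (hW : Nondeg W) (hWσ : W 1 - W 3 = σ * (W 0 - W 2)) : Step Z W := by
  have hσ0 : σ ≠ 0 := by rintro rfl; simp at hσ
  have hF' : conj (Z 1 - Z 2) ≠ 0 := by rwa [Ne, map_eq_zero]
  have hE' : conj (Z 0 - Z 1) ≠ 0 := by rw [hE]; exact mul_ne_zero hσ0 hF'
  have hE0 : Z 0 - Z 1 ≠ 0 := by rwa [Ne, map_eq_zero] at hE'
  have h01 : Z 0 ≠ Z 1 := sub_ne_zero.1 hE0
  have h12 : Z 1 ≠ Z 2 := sub_ne_zero.1 hF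
  have h32 : Z 3 ≠ Z 2 := sub_ne_zero.1 (hp ▸ hE0)
  have h23 := h32.symm
  have h03' : Z 0 - Z 3 = Z 1 - Z 2 := by linear_combination hp
  have h03 : Z 0 ≠ Z 3 := sub_ne_zero.1 (h03' ▸ hF)
  have h30 := h03.symm
  have hD : W 0 - W 2 ≠ 0 := sub_ne_zero.2 hW.diagonal_ne
  have w02 : wdir (Z 2) (Z 3) = wdir (Z 0) (Z 1) := by
    unfold wdir; rw [← hp, ← neg_sub (Z 0) (Z 1), map_neg, neg_div_neg_eq]
  have w13 : wdir (Z 3) (Z 0) = wdir (Z 1) (Z 2) := by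
    unfold wdir; rw [h03', ← neg_sub (Z 1) (Z 2), map_neg, neg_div_neg_eq]
  have w0 : wdir (Z 0) (Z 1) * conj (Z 0 - Z 1) = Z 0 - Z 1 := by
    unfold wdir; rw [← neg_sub (Z 0) (Z 1), map_neg]; field_simp
  have w1 : wdir (Z 1) (Z 2) * conj (Z 1 - Z 2) = Z 1 - Z 2 := by
    unfold wdir; rw [← neg_sub (Z 1) (Z 2), map_neg]; field_simp
  set E := Z 0 - Z 1 with hEd
  set F := Z 1 - Z 2 with hFd
  set G := (F * conj E - E * conj F) / 2 with hG
  have hG0 : G ≠ 0 := by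
    have hn : 0 < Complex.normSq F := Complex.normSq_pos.2 hF
    have e1 : conj E = σ * conj F := hE
    have e2 : E = conj σ * F := by
      have := congrArg conj hE
      simpa using this
    have : G = (Complex.normSq F * σ.im : ℝ) * Complex.I := by
      rw [hG, e1, e2, ]
      apply Complex.ext <;> simp [Complex.normSq_apply] <;> ring
    rw [this]
    exact mul_ne_zero (by exact_mod_cast mul_ne_zero hn.ne' hσ) Complex.I_ne_zero
  have hcr : cross (Z 1 - Z 0) (Z 2 - Z 1) ≠ 0 := by
    intro h
    apply hG0
    have := ofReal_cross (Z 1 - Z 0) (Z 2 - Z 1)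
    rw [h, ← neg_sub (Z 0) (Z 1), ← neg_sub (Z 1) (Z 2), map_neg, map_neg] at this
    have h2 : Complex.I * G = 0 := by
      rw [hG, hEd, hFd]; rw [Complex.ofReal_zero] at this; linear_combination this
    simpa using h2
  have hw := wdir_ne hcr
  set l := G / (conj E * (W 0 - W 2)) with hl
  have hl0 : l ≠ 0 := div_ne_zero hG0 (mul_ne_zero hE' hD)
  set X := Z 1 + conj (2 * l * (W 0 - W 1) / (wdir (Z 0) (Z 1) - wdir (Z 1) (Z 2))) with hX
  have d01 : cfoot (Z 0) (Z 1) X - cfoot (Z 1) (Z 2) X = l * (W 0 - W 1) := by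
    rw [cfoot_sub_cfoot h01 h12, hX, add_sub_cancel_left, Complex.conj_conj]
    field_simp
  have hl1 : l * (W 0 - W 2) * conj E = G := by rw [hl]; field_simp
  have d02 : cfoot (Z 0) (Z 1) X - cfoot (Z 2) (Z 3) X = l * (W 0 - W 2) := by
    rw [cfoot_eq_start h01, cfoot_eq_end h23, w02]
    have : conj (Z 0 - Z 3) = conj F := by rw [h03']
    apply mul_right_cancel₀ hE'
    rw [hl1, hG, ← h03']
    simp only [map_sub] at *
    linear_combination (1/2 : ℂ) * (conj (Z 3) - conj (Z 0)) * w0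
  have d13 : cfoot (Z 1) (Z 2) X - cfoot (Z 3) (Z 0) X = l * (W 1 - W 3) := by
    rw [cfoot_eq_start h12, cfoot_eq_end h30, w13]
    have h2 : l * (W 1 - W 3) * conj F = G := by
      rw [hWσ, ← hl1]; linear_combination -l * (W 0 - W 2) * hE
    apply mul_right_cancel₀ hF'
    rw [h2, hG]
    have : conj E = conj (Z 0) - conj (Z 1) := by rw [hEd, map_sub]
    rw [this, hEd]
    simp only [map_sub] at *
    linear_combination (1/2 : ℂ) * (conj (Z 0) - conj (Z 1)) * w1
  refine ⟨hW, X, l, cfoot (Z 0) (Z 1) X - l * W 0, hl0, forall_zmod_four.2 ⟨?_, ?_, ?_, ?_⟩⟩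
  · change cfoot (Z 0) (Z 1) X = _; ring
  · change cfoot (Z 1) (Z 2) X = _; linear_combination -d01
  · change cfoot (Z 2) (Z 3) X = _; linear_combination -d02
  · change cfoot (Z 3) (Z 0) X = _; linear_combination -d01 - d13

/-- Opposite sides are not perpendicular in both pairs. -/
def NotOrthocentric (V : ZMod 4 → ℂ) : Prop :=
  dot (V 1 - V 0) (V 3 - V 2) ≠ 0 ∨ dot (V 2 - V 1) (V 0 - V 3) ≠ 0

/-- `V` has a nondegenerate pedal parallelogram whose own pedal quadrilaterals have
diagonals of ratio `σ`. -/
structure HasState (V : ZMod 4 → ℂ) (σ : ℂ) : Prop where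
  nondeg : Nondeg V
  notOrtho : NotOrthocentric V
  im_ne : σ.im ≠ 0
  eq : σ * (cross (V 2 - V 1) (V 3 - V 2) * cross (V 0 - V 3) (V 1 - V 0)) * (V 0 - V 2) =
    cross (V 1 - V 0) (V 2 - V 1) * cross (V 3 - V 2) (V 0 - V 3) * (V 1 - V 3)

lemma dot_eq_zero_of_wdir_add {A B C D : ℂ} (h : A ≠ B) (h' : C ≠ D)
    (hw : wdir A B + wdir C D = 0) : dot (B - A) (D - C) = 0 := by
  have h1 := conj_sub_ne_zero h
  have h2 := conj_sub_ne_zero h'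
  have : ((dot (B - A) (D - C) : ℝ) : ℂ) = 0 := by
    rw [ofReal_dot]
    unfold wdir at hw
    field_simp at hw
    linear_combination hw / 2
  exact_mod_cast this

/-- If two pairs of unit complex numbers have the same nonzero sum, the pairs coincide. -/
lemma add_eq_zero_of_unit {a b c d a' b' c' d' : ℂ} (ha : a * a' = 1) (hb : b * b' = 1)
    (hc : c * c' = 1) (hd : d * d' = 1) (hab : a - b ≠ 0) (hda : d - a ≠ 0)
    (h : a + c = b + d) (h' : a' + c' = b' + d') : a + c = 0 := by
  by_contra hs
  have e : (a + c) * (b * d) = (a + c) * (a * c) := by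
    have e1 : a * c * (a' + c') = a + c := by linear_combination c * ha + a * hc
    have e2 : b * d * (b' + d') = b + d := by linear_combination d * hb + b * hd
    rw [h'] at e1
    linear_combination (-b * d) * e1 + (a * c) * e2 - a * c * h
  have e' := mul_left_cancel₀ hs e
  have : (a - b) * (d - a) = 0 := by linear_combination -a * h - e'
  exact (mul_ne_zero hab hda) this

lemma HasState.exists_parallelogram {V : ZMod 4 → ℂ} {σ : ℂ} (h : HasState V σ) :
    ∃ Z, Step V Z ∧ Z 0 - Z 1 = Z 3 - Z 2 ∧ Z 1 - Z 2 ≠ 0 ∧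
      conj (Z 0 - Z 1) = σ * conj (Z 1 - Z 2) := by
  obtain ⟨hV, hO, hσ, hs⟩ := h
  obtain ⟨s0, s1, s2, s3⟩ := hV.sides_ne
  obtain ⟨n0, n1, n2, n3⟩ := hV
  have w01 := wdir_ne n0
  have w12 := wdir_ne n1
  have w23 := wdir_ne n2
  have w30 := wdir_ne n3
  have k01 := wdir_sub_wdir s0 s1
  have k12 := wdir_sub_wdir s1 s2
  have k23 := wdir_sub_wdir s2 s3
  have k30 := wdir_sub_wdir s3 s0
  have u0 := wdir_mul_conj s0
  have u1 := wdir_mul_conj s1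
  have u2 := wdir_mul_conj s2
  have u3 := wdir_mul_conj s3
  have hz : wdir (V 0) (V 1) - wdir (V 1) (V 2) + wdir (V 2) (V 3) - wdir (V 3) (V 0) ≠ 0 := by
    intro hz
    have hz1 : wdir (V 0) (V 1) + wdir (V 2) (V 3) = wdir (V 1) (V 2) + wdir (V 3) (V 0) := by
      linear_combination hz
    have hz2 := congrArg conj hz1
    rw [map_add, map_add] at hz2
    have e1 := add_eq_zero_of_unit u0 u1 u2 u3 w01 w30 hz1 hz2
    rcases hO with hO | hO
    · exact hO (dot_eq_zero_of_wdir_add s0 s2 e1)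
    · exact hO (dot_eq_zero_of_wdir_add s1 s3 (hz1 ▸ e1))
  have c0 := conj_sub_ne_zero s0
  have c1 := conj_sub_ne_zero s1
  have c2 := conj_sub_ne_zero s2
  have c3 := conj_sub_ne_zero s3
  set w0 := wdir (V 0) (V 1)
  set w1 := wdir (V 1) (V 2)
  set w2 := wdir (V 2) (V 3)
  set w3 := wdir (V 3) (V 0)
  set X := conj (((w0 - w1) * conj (V 1) + (w2 - w3) * conj (V 3)) / (w0 - w1 + w2 - w3)) with hX
  have hX' : conj X * (w0 - w1 + w2 - w3) = (w0 - w1) * conj (V 1) + (w2 - w3) * conj (V 3) := by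
    rw [hX, Complex.conj_conj]; field_simp
  set Z : ZMod 4 → ℂ := fun i => cfoot (V i) (V (i + 1)) X with hZ
  have z01 : Z 0 - Z 1 = (w0 - w1) * conj (X - V 1) / 2 := cfoot_sub_cfoot s0 s1 X
  have z12 : Z 1 - Z 2 = (w1 - w2) * conj (X - V 2) / 2 := cfoot_sub_cfoot s1 s2 X
  have z23 : Z 2 - Z 3 = (w2 - w3) * conj (X - V 3) / 2 := cfoot_sub_cfoot s2 s3 X
  have z30 : Z 3 - Z 0 = (w3 - w0) * conj (X - V 0) / 2 := cfoot_sub_cfoot s3 s0 X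
  have hp : Z 0 - Z 1 = Z 3 - Z 2 := by
    simp only [map_sub] at *
    linear_combination z01 + z23 + hX' / 2
  have hE : 2 * (Z 0 - Z 1) * (w0 - w1 + w2 - w3) = (w0 - w1) * (w2 - w3) * conj (V 3 - V 1) := by
    simp only [map_sub] at *
    linear_combination 2 * (w0 - w1 + w2 - w3) * z01 + (w0 - w1) * hX'
  have hF : 2 * (Z 1 - Z 2) * (w0 - w1 + w2 - w3) = (w1 - w2) * (w0 - w3) * conj (V 0 - V 2) := by
    have e : (w1 - w2) * conj (X - V 2) = (w0 - w3) * conj (X - V 0) := by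
      linear_combination -2 * z12 - 2 * z30 - 2 * hp
    simp only [map_sub] at *
    linear_combination 2 * (w0 - w1 + w2 - w3) * z12 - (w1 - w2) * e
  have hd : V 0 - V 2 ≠ 0 := sub_ne_zero.2 (Nondeg.diagonal_ne ⟨n0, n1, n2, n3⟩)
  have hF0 : Z 1 - Z 2 ≠ 0 := by
    intro e
    rw [e] at hF
    have : (w1 - w2) * (w0 - w3) * conj (V 0 - V 2) ≠ 0 :=
      mul_ne_zero (mul_ne_zero w12 (by rw [← neg_sub]; exact neg_ne_zero.2 w30))
        (by rwa [Ne, map_eq_zero])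
    apply this; rw [← hF]; ring
  have hEF : Z 0 - Z 1 = conj σ * (Z 1 - Z 2) := by
    have hs' := congrArg conj hs
    simp only [map_mul, Complex.conj_ofReal] at hs'
    have e1 : 2 * (w0 - w1 + w2 - w3) ≠ 0 := mul_ne_zero two_ne_zero hz
    apply mul_left_cancel₀ e1
    have e2 : (w0 - w1) * (w2 - w3) * conj (V 3 - V 1) =
        conj σ * ((w1 - w2) * (w0 - w3) * conj (V 0 - V 2)) := by
      have k03 : w0 - w3 = -(w3 - w0) := by ring
      rw [k03, k01, k12, k23, k30, ← neg_sub (V 1) (V 3), map_neg]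
      field_simp
      linear_combination hs'
    linear_combination hE + e2 - conj σ * hF
  have hEF' : conj (Z 0 - Z 1) = σ * conj (Z 1 - Z 2) := by
    rw [hEF, map_mul, Complex.conj_conj]
  refine ⟨Z, ⟨?_, X, 1, 0, one_ne_zero, fun i => by simp [hZ]⟩, hp, hF0, hEF'⟩
  have hc : cross (Z 0 - Z 1) (Z 1 - Z 2) ≠ 0 := by
    have e : cross (Z 0 - Z 1) (Z 1 - Z 2) = Complex.normSq (Z 1 - Z 2) * σ.im := by
      rw [hEF]
      simp only [cross, Complex.mul_re, Complex.mul_im, Complex.conj_re, Complex.conj_im,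
        Complex.normSq_apply]
      ring
    rw [e]
    exact mul_ne_zero (Complex.normSq_pos.2 hF0).ne' hσ
  have p1 := congrArg Complex.re hp
  have p2 := congrArg Complex.im hp
  simp only [Complex.sub_re, Complex.sub_im] at p1 p2
  have q1 : (Z 3).re = (Z 0).re - (Z 1).re + (Z 2).re := by linarith
  have q2 : (Z 3).im = (Z 0).im - (Z 1).im + (Z 2).im := by linarith
  refine ⟨?_, ?_, ?_, ?_⟩ <;> intro e0 <;> apply hc <;>
    simp only [cross, Complex.sub_re, Complex.sub_im, q1, q2] at e0 ⊢ <;> linarith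

lemma HasState.transGen {V W : ZMod 4 → ℂ} {σ : ℂ} (h : HasState V σ) (hW : Nondeg W)
    (hWσ : W 1 - W 3 = σ * (W 0 - W 2)) : Relation.TransGen Step V W := by
  obtain ⟨Z, h1, h2, h3, h4⟩ := h.exists_parallelogram
  exact .tail (.single h1) (step_of_parallelogram h.im_ne h2 h3 h4 hW hWσ)

/-- The state of a quadrilateral is its ratio of diagonals up to a nonzero real factor. -/
lemma exists_hasState {V : ZMod 4 → ℂ} {δ : ℂ} (hV : Nondeg V) (hO : NotOrthocentric V)
    (hδ : δ.im ≠ 0) (h : V 1 - V 3 = δ * (V 0 - V 2)) :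
    ∃ μ : ℝ, μ ≠ 0 ∧ HasState V (μ * δ) := by
  obtain ⟨n0, n1, n2, n3⟩ := hV
  have hμ : cross (V 1 - V 0) (V 2 - V 1) * cross (V 3 - V 2) (V 0 - V 3) /
    (cross (V 2 - V 1) (V 3 - V 2) * cross (V 0 - V 3) (V 1 - V 0)) ≠ 0 :=
    div_ne_zero (mul_ne_zero n0 n2) (mul_ne_zero n1 n3)
  refine ⟨_, hμ, ⟨n0, n1, n2, n3⟩, hO, ?_, ?_⟩
  · rw [Complex.im_ofReal_mul]; exact mul_ne_zero hμ hδ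
  · have e1 : ((cross (V 2 - V 1) (V 3 - V 2) : ℝ) : ℂ) ≠ 0 := by exact_mod_cast n1
    have e2 : ((cross (V 0 - V 3) (V 1 - V 0) : ℝ) : ℂ) ≠ 0 := by exact_mod_cast n3
    rw [h]
    push_cast
    field_simp

/-- The ratio of diagonals can be rescaled by almost every real factor. -/
lemma exists_hasState_smul {δ : ℂ} (hδ : δ.im ≠ 0) {r : ℝ} (hr : r ≠ 0)
    (hrδ : r * Complex.normSq δ ≠ -1) :
    ∃ Y : ZMod 4 → ℂ, Y 1 - Y 3 = δ * (Y 0 - Y 2) ∧ HasState Y (r * δ) := by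
  obtain ⟨s, t, hs0, hs1, ht0, ht1, hst⟩ : ∃ s t : ℝ, s ≠ 0 ∧ 1 - s ≠ 0 ∧ t ≠ 0 ∧ 1 - t ≠ 0 ∧
      t * (1 - t) = r * (s * (1 - s)) := by
    by_cases h : r = 1 ∨ r = -1
    · refine ⟨-1 / (1 - 4 * r), -2 * r / (1 - 4 * r), ?_⟩
      rcases h with rfl | rfl <;> norm_num
    · push Not at h
      have h1 : 1 - r ≠ 0 := sub_ne_zero.2 h.1.symm
      have h2 : 1 + r ≠ 0 := fun e => h.2 (by linarith)
      have h3 : 1 - 2 / (1 - r) = -(1 + r) / (1 - r) := by field_simp; ring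
      have h4 : 1 - -(2 * r) / (1 - r) = (1 + r) / (1 - r) := by field_simp; ring
      refine ⟨2 / (1 - r), -(2 * r) / (1 - r), by positivity, ?_, ?_, ?_, ?_⟩
      · rw [h3]; exact div_ne_zero (neg_ne_zero.2 h2) h1
      · exact div_ne_zero (by simpa using hr) h1
      · rw [h4]; exact div_ne_zero h2 h1
      · rw [h3, h4]; field_simp
  set Y := quad s (t * δ) (s - 1) ((t - 1) * δ) with hY
  have k0 : cross (Y 1 - Y 0) (Y 2 - Y 1) = t * δ.im := by
    simp [hY, cross]; ring
  have k1 : cross (Y 2 - Y 1) (Y 3 - Y 2) = (1 - s) * δ.im := by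
    simp [hY, cross]; ring
  have k2 : cross (Y 3 - Y 2) (Y 0 - Y 3) = (1 - t) * δ.im := by
    simp [hY, cross]; ring
  have k3 : cross (Y 0 - Y 3) (Y 1 - Y 0) = s * δ.im := by
    simp [hY, cross]; ring
  refine ⟨Y, by simp [hY]; ring, ⟨?_, ?_, ?_, ?_⟩, ?_, ?_, ?_⟩
  · rw [k0]; exact mul_ne_zero ht0 hδ
  · rw [k1]; exact mul_ne_zero hs1 hδ
  · rw [k2]; exact mul_ne_zero ht1 hδ
  · rw [k3]; exact mul_ne_zero hs0 hδ
  · by_contra hO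
    simp only [NotOrthocentric, not_or, not_not] at hO
    obtain ⟨e1, e2⟩ := hO
    simp [hY, dot] at e1 e2
    have hre : δ.re = 0 := by linarith
    rw [hre] at e1 e2
    have : s * (1 - s) * (r * Complex.normSq δ + 1) = 0 := by
      rw [Complex.normSq_apply, hre]; linear_combination -e1 - δ.im ^ 2 * hst
    have h5 : r * Complex.normSq δ + 1 ≠ 0 := fun e => hrδ (by linarith)
    exact mul_ne_zero (mul_ne_zero hs0 hs1) h5 this
  · simpa using ⟨hr, hδ⟩
  · rw [k0, k1, k2, k3]
    have hst' : (t : ℂ) * (1 - t) = r * (s * (1 - s)) := by exact_mod_cast hst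
    simp [hY]
    linear_combination (-(δ.im : ℂ) ^ 2 * δ) * hst'

lemma exists_ratio {z w : ℂ} (h : cross z w ≠ 0) : ∃ δ : ℂ, δ.im ≠ 0 ∧ w = δ * z := by
  have hz := ne_zero_left_of_cross h
  have hδ : w = w / z * z := by field_simp
  refine ⟨w / z, fun h0 => h ?_, hδ⟩
  rw [hδ]
  simp only [cross, Complex.mul_re, Complex.mul_im, h0]
  ring

lemma Continuous.eventually_ne_punctured {f : ℝ → ℝ} (hf : Continuous f) (h0 : f 0 ≠ 0) :
    ∀ᶠ x in nhdsWithin (0 : ℝ) {0}ᶜ, f x ≠ 0 :=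
  (hf.continuousAt.eventually_ne h0).filter_mono nhdsWithin_le_nhds

lemma eventually_cofinite_affine_ne {a b : ℝ} (h : a ≠ 0 ∨ b ≠ 0) :
    ∀ᶠ t : ℝ in Filter.cofinite, a + t * b ≠ 0 := by
  by_cases hb : b = 0
  · have ha : a ≠ 0 := h.resolve_right (not_not.2 hb)
    exact Filter.Eventually.of_forall fun t => by simpa [hb] using ha
  · filter_upwards [Set.Finite.compl_mem_cofinite (Set.finite_singleton (-a / b))] with t ht e
    apply ht
    rw [Set.mem_singleton_iff]
    field_simp
    linarith

lemma cfoot_eq_add_normal {A B : ℂ} (h : A ≠ B) (X : ℂ) :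
    cfoot A B X = X + (cross (B - A) (A - X) : ℝ) *
      (Complex.I * (B - A) / (dot (B - A) (B - A) : ℝ)) := by
  have hd := (dot_self_pos (sub_ne_zero.2 h.symm)).ne'
  have e : (cross (B - A) (A - X) : ℂ) * (Complex.I * (B - A) / (dot (B - A) (B - A) : ℝ)) =
      ((cross (B - A) (A - X) / dot (B - A) (B - A) : ℝ) : ℂ) * (Complex.I * (B - A)) := by
    push_cast; ring
  rw [e]
  have hm : cross (B - A) (A - X) / dot (B - A) (B - A) * dot (B - A) (B - A) =
    cross (B - A) (A - X) := by field_simp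
  generalize cross (B - A) (A - X) / dot (B - A) (B - A) = m at *
  apply cfoot_eq_of h
  · simp [cross, dot] at hm ⊢
    linear_combination -hm
  · simp [dot]
    ring

lemma cross_normal (d e : ℂ) :
    cross (Complex.I * d / (dot d d : ℝ)) (Complex.I * e / (dot e e : ℝ)) =
      cross d e / (dot d d * dot e e) := by
  simp only [cross, Complex.div_ofReal_re, Complex.div_ofReal_im, Complex.mul_re, Complex.mul_im,
    Complex.I_re, Complex.I_im]
  rw [div_mul_div_comm, div_mul_div_comm, ← sub_div]
  ring_nf

/-- Points on four lines through the origin, two of them close to the origin, are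
in general position for suitable speeds. -/
lemma exists_generic_on_rays {g0 g1 g2 g3 : ℂ} {A B : ℝ} (h01 : cross g0 g1 ≠ 0)
    (h12 : cross g1 g2 ≠ 0) (h23 : cross g2 g3 ≠ 0) (h30 : cross g3 g0 ≠ 0)
    (hA : A ≠ 0) (hB : B ≠ 0) :
    ∃ α β : ℝ, ∀ A' B' : ℝ, ∃ x : ℝ, ∃ q : ZMod 4 → ℂ,
      q = quad ((x * α : ℝ) * g0) ((x * β : ℝ) * g1) ((A + x * A' : ℝ) * g2)
        ((B + x * B' : ℝ) * g3) ∧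
      Nondeg q ∧ NotOrthocentric q ∧ cross (q 0 - q 2) (q 1 - q 3) ≠ 0 := by
  set e : ℂ := B * g3 - A * g2 with he
  have hge : dot g1 e ≠ 0 ∨ -dot g0 e ≠ 0 := by
    by_contra! hc
    obtain ⟨e1, e2⟩ := hc
    have e2 : dot g0 e = 0 := neg_eq_zero.1 e2
    have r1 : e.re * cross g0 g1 = 0 := by
      have : e.re * cross g0 g1 = dot g0 e * g1.im - dot g1 e * g0.im := by
        simp only [cross, dot]; ring
      rw [this, e1, e2]; ring
    have r2 : e.im * cross g0 g1 = 0 := by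
      have : e.im * cross g0 g1 = dot g1 e * g0.re - dot g0 e * g1.re := by
        simp only [cross, dot]; ring
      rw [this, e1, e2]; ring
    have z1 := (mul_eq_zero.1 r1).resolve_right h01
    have z2 := (mul_eq_zero.1 r2).resolve_right h01
    have : B * cross g2 g3 = cross g2 e := by
      rw [he]; simp [cross]; ring
    have h0 : cross g2 e = 0 := by simp [cross, z1, z2]
    exact mul_ne_zero hB h23 (this.trans h0)
  obtain ⟨t, ht1, ht2, ht3⟩ := ((eventually_cofinite_affine_ne (b := cross g2 g0) (Or.inl h12)).and
    ((eventually_cofinite_affine_ne (a := cross g1 g3) (Or.inr h30)).and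
      (eventually_cofinite_affine_ne hge))).exists
  refine ⟨t, 1, fun A' B' => ?_⟩
  have hAB : A * B * cross g2 g3 ≠ 0 := mul_ne_zero (mul_ne_zero hA hB) h23
  set p : ℝ → ZMod 4 → ℂ := fun x => quad ((x * t : ℝ) * g0) ((x * 1 : ℝ) * g1)
    ((A + x * A' : ℝ) * g2) ((B + x * B' : ℝ) * g3) with hp
  have k0 : ∀ x, cross (p x 1 - p x 0) (p x 2 - p x 1) =
      x * (x * t * cross g0 g1 + (A + x * A') * (cross g1 g2 + t * cross g2 g0)) := by
    intro x; simp [hp, cross]; ring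
  have k1 : ∀ x, cross (p x 2 - p x 1) (p x 3 - p x 2) =
      x * (A + x * A') * cross g1 g2 + (A + x * A') * (B + x * B') * cross g2 g3 +
        (B + x * B') * x * cross g3 g1 := by
    intro x; simp [hp, cross]; ring
  have k2 : ∀ x, cross (p x 3 - p x 2) (p x 0 - p x 3) =
      (A + x * A') * (B + x * B') * cross g2 g3 + (B + x * B') * x * t * cross g3 g0 +
        x * t * (A + x * A') * cross g0 g2 := by
    intro x; simp [hp, cross]; ring
  have k3 : ∀ x, cross (p x 0 - p x 3) (p x 1 - p x 0) =
      x * (x * t * cross g0 g1 + (B + x * B') * (cross g1 g3 + t * cross g3 g0)) := by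
    intro x; simp [hp, cross]; ring
  have k4 : ∀ x, dot (p x 1 - p x 0) (p x 3 - p x 2) =
      x * ((B + x * B') * (dot g1 g3 - t * dot g0 g3) -
        (A + x * A') * (dot g1 g2 - t * dot g0 g2)) := by
    intro x; simp [hp, dot]; ring
  have k5 : ∀ x, cross (p x 0 - p x 2) (p x 1 - p x 3) =
      x ^ 2 * t * cross g0 g1 + x * t * (B + x * B') * cross g3 g0 +
        (A + x * A') * x * cross g1 g2 + (A + x * A') * (B + x * B') * cross g2 g3 := by
    intro x; simp [hp, cross]; ring
  have ex : ∀ᶠ x in nhdsWithin (0 : ℝ) {0}ᶜ, x ≠ 0 := eventually_mem_nhdsWithin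
  have E0 := Continuous.eventually_ne_punctured (f := fun x => x * t * cross g0 g1 +
    (A + x * A') * (cross g1 g2 + t * cross g2 g0)) (by fun_prop) (by simpa using ⟨hA, ht1⟩)
  have E1 := Continuous.eventually_ne_punctured (f := fun x => cross (p x 2 - p x 1) (p x 3 - p x 2))
    (by simp only [k1]; fun_prop) (by simp only [k1]; simpa using ⟨⟨hA, hB⟩, h23⟩)
  have E2 := Continuous.eventually_ne_punctured (f := fun x => cross (p x 3 - p x 2) (p x 0 - p x 3))
    (by simp only [k2]; fun_prop) (by simp only [k2]; simpa using ⟨⟨hA, hB⟩, h23⟩)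
  have E3 := Continuous.eventually_ne_punctured (f := fun x => x * t * cross g0 g1 +
    (B + x * B') * (cross g1 g3 + t * cross g3 g0)) (by fun_prop) (by simpa using ⟨hB, ht2⟩)
  have E4 := Continuous.eventually_ne_punctured (f := fun x =>
    (B + x * B') * (dot g1 g3 - t * dot g0 g3) - (A + x * A') * (dot g1 g2 - t * dot g0 g2))
    (by fun_prop) (by
      have : dot g1 e + t * -dot g0 e = B * (dot g1 g3 - t * dot g0 g3) -
          A * (dot g1 g2 - t * dot g0 g2) := by
        rw [he]; simp [dot]; ring
      rw [this] at ht3; simpa using ht3)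
  have E5 := Continuous.eventually_ne_punctured (f := fun x => cross (p x 0 - p x 2) (p x 1 - p x 3))
    (by simp only [k5]; fun_prop) (by simp only [k5]; simpa using ⟨⟨hA, hB⟩, h23⟩)
  obtain ⟨x, hx, x0, x1, x2, x3, x4, x5⟩ :=
    (ex.and (E0.and (E1.and (E2.and (E3.and (E4.and E5)))))).exists
  refine ⟨x, p x, rfl, ⟨?_, x1, x2, ?_⟩, Or.inl ?_, x5⟩
  · rw [k0]; exact mul_ne_zero hx x0
  · rw [k3]; exact mul_ne_zero hx x3
  · rw [k4]; exact mul_ne_zero hx x4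

/-- Every nondegenerate quadrilateral has a pedal quadrilateral in general position. -/
lemma exists_step_generic {V : ZMod 4 → ℂ} (hV : Nondeg V) :
    ∃ q, Step V q ∧ NotOrthocentric q ∧ cross (q 0 - q 2) (q 1 - q 3) ≠ 0 := by
  obtain ⟨s0, s1, s2, s3⟩ := hV.sides_ne
  have f0 := cfoot_eq_add_normal s0
  have f1 := cfoot_eq_add_normal s1
  have f2 := cfoot_eq_add_normal s2
  have f3 := cfoot_eq_add_normal s3
  obtain ⟨n0, n1, n2, n3⟩ := hV
  have p0 := (dot_self_pos (sub_ne_zero.2 s0.symm)).ne'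
  have p1 := (dot_self_pos (sub_ne_zero.2 s1.symm)).ne'
  have p2 := (dot_self_pos (sub_ne_zero.2 s2.symm)).ne'
  have p3 := (dot_self_pos (sub_ne_zero.2 s3.symm)).ne'
  obtain ⟨α, β, hq⟩ := exists_generic_on_rays
    (A := cross (V 3 - V 2) (V 2 - V 1)) (B := cross (V 0 - V 3) (V 3 - V 1))
    ((cross_normal _ _).trans_ne (div_ne_zero n0 (mul_ne_zero p0 p1)))
    ((cross_normal _ _).trans_ne (div_ne_zero n1 (mul_ne_zero p1 p2)))
    ((cross_normal _ _).trans_ne (div_ne_zero n2 (mul_ne_zero p2 p3)))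
    ((cross_normal _ _).trans_ne (div_ne_zero n3 (mul_ne_zero p3 p0)))
    (fun e => n1 (by simp only [cross] at e ⊢; linarith))
    (fun e => n3 (by simp only [cross, Complex.sub_re, Complex.sub_im] at e ⊢; linarith))
  set D := cross (V 1 - V 0) (V 2 - V 1) with hD
  set u : ℂ := ((β / D : ℝ) : ℂ) * (V 1 - V 0) - ((α / D : ℝ) : ℂ) * (V 2 - V 1) with hu
  obtain ⟨x, q, hqx, q1, q2, q3⟩ := hq (-cross (V 3 - V 2) u) (-cross (V 0 - V 3) u)
  refine ⟨q, ⟨q1, V 1 + x * u, 1, V 1 + x * u, one_ne_zero, ?_⟩, q2, q3⟩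
  have hα : cross (V 1 - V 0) u = -α := by
    have : cross (V 1 - V 0) u = -(α / D * D) := by
      rw [hu, hD]; simp only [cross, Complex.sub_re, Complex.sub_im, Complex.re_ofReal_mul,
        Complex.im_ofReal_mul]; ring
    rw [this, div_mul_cancel₀ _ n0]
  have hβ : cross (V 2 - V 1) u = -β := by
    have : cross (V 2 - V 1) u = -(β / D * D) := by
      rw [hu, hD]; simp only [cross, Complex.sub_re, Complex.sub_im, Complex.re_ofReal_mul,
        Complex.im_ofReal_mul]; ring
    rw [this, div_mul_cancel₀ _ n0]
  have key : ∀ d z : ℂ, cross d (z - (V 1 + x * u)) = cross d (z - V 1) - x * cross d u := by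
    intro d z
    simp only [cross, Complex.sub_re, Complex.sub_im, Complex.add_re, Complex.add_im,
      Complex.re_ofReal_mul, Complex.im_ofReal_mul]
    ring
  have m0 : cross (V 1 - V 0) (V 0 - V 1) = 0 := by
    simp only [cross, Complex.sub_re, Complex.sub_im]; ring
  have m1 : cross (V 2 - V 1) (V 1 - V 1) = 0 := by simp [cross]
  rw [hqx]
  refine forall_zmod_four.2 ⟨?_, ?_, ?_, ?_⟩
  · change cfoot (V 0) (V 1) _ = _
    rw [f0, key, m0, hα, quad_zero, show 0 - x * -α = x * α by ring]; ring
  · change cfoot (V 1) (V 2) _ = _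
    rw [f1, key, m1, hβ, quad_one, show 0 - x * -β = x * β by ring]; ring
  · change cfoot (V 2) (V 3) _ = _
    rw [f2, key, quad_two, mul_neg, ← sub_eq_add_neg]; ring
  · change cfoot (V 3) (V 0) _ = _
    rw [f3, key, quad_three, mul_neg, ← sub_eq_add_neg]; ring

/-- Trapezoids with prescribed ratio of diagonals have pedal quadrilaterals whose diagonals
make any prescribed angle. -/
lemma exists_step_trapezoid {δ c : ℂ} (hδ : δ.im ≠ 0) (hc : c.im ≠ 0) :
    ∃ Y q : ZMod 4 → ℂ, Nondeg Y ∧ Y 1 - Y 3 = δ * (Y 0 - Y 2) ∧ Step Y q ∧ NotOrthocentric q ∧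
      ∃ ρ : ℝ, ρ ≠ 0 ∧ q 1 - q 3 = ρ * c * (q 0 - q 2) := by
  have hδ1 : δ - 1 ≠ 0 := by
    intro e; apply hδ; rw [sub_eq_zero.1 e]; simp
  obtain ⟨z, hz⟩ : ∃ z : ℂ, z * (δ - 1) = 1 := ⟨(δ - 1)⁻¹, inv_mul_cancel₀ hδ1⟩
  have hzi : z.im ≠ 0 := by
    intro h0
    have e1 := congrArg Complex.re hz
    have e2 := congrArg Complex.im hz
    simp [h0] at e1 e2
    rcases e2 with e2 | e2
    · simp [e2] at e1
    · exact hδ e2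
  have punctured : ∀ᶠ x in nhdsWithin (0 : ℝ) {0}ᶜ, x ≠ 0 := eventually_mem_nhdsWithin
  obtain ⟨t, ht0, ht1, ht2, ht3, ht4⟩ := (punctured.and <|
    (Continuous.eventually_ne_punctured (f := fun t => t - 1) (by fun_prop) (by norm_num)).and <|
    (Continuous.eventually_ne_punctured (f := fun t => t - 2) (by fun_prop) (by norm_num)).and <|
    (Continuous.eventually_ne_punctured (f := fun t => c.re * (t * z.im) - c.im * (1 + t * z.re))
      (by fun_prop) (by simpa using hc)).and
    (Continuous.eventually_ne_punctured (f := fun t => c.re * (t * z.im) - c.im * (t - 1 + t * z.re))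
      (by fun_prop) (by simpa using hc))).exists
  obtain ⟨k, rfl⟩ : ∃ k, t = k + 1 := ⟨t - 1, by ring⟩
  have hk0 : k ≠ 0 := fun e => ht1 (by linarith)
  have hk1 : k - 1 ≠ 0 := fun e => ht2 (by linarith)
  obtain ⟨η, hη⟩ : ∃ η, η = (k + 1) * z.im := ⟨_, rfl⟩
  obtain ⟨u, hu⟩ : ∃ u, u = 1 + (k + 1) * z.re := ⟨_, rfl⟩
  obtain ⟨v, hv⟩ : ∃ v, v = k + (k + 1) * z.re := ⟨_, rfl⟩
  have hη0 : η ≠ 0 := hη ▸ mul_ne_zero ht0 hzi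
  have huv : u - v ≠ 0 := by rw [hu, hv]; intro e; apply hk1; linarith
  rw [← hη, ← hu] at ht3
  rw [← hη, add_sub_cancel_right, ← hv] at ht4
  set a : ℂ := ⟨u, η⟩ with ha
  set b : ℂ := ⟨v, η⟩ with hb
  set Y := quad b a (k * a) (k * b) with hY
  have hYnd : Nondeg Y := by
    have k0 : cross (Y 1 - Y 0) (Y 2 - Y 1) = (u - v) * (k - 1) * η := by
      simp [hY, cross, ha, hb]; ring
    have k1 : cross (Y 2 - Y 1) (Y 3 - Y 2) = (u - v) * (k - 1) * k * η := by
      simp [hY, cross, ha, hb]; ring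
    have k2 : cross (Y 3 - Y 2) (Y 0 - Y 3) = (u - v) * (k - 1) * k * η := by
      simp [hY, cross, ha, hb]; ring
    have k3 : cross (Y 0 - Y 3) (Y 1 - Y 0) = (u - v) * (k - 1) * η := by
      simp [hY, cross, ha, hb]; ring
    refine ⟨?_, ?_, ?_, ?_⟩
    · rw [k0]; positivity
    · rw [k1]; positivity
    · rw [k2]; positivity
    · rw [k3]; positivity
  have hYδ : Y 1 - Y 3 = δ * (Y 0 - Y 2) := by
    have ea : a = 1 + (k + 1) * z := by
      apply Complex.ext <;> simp [ha, hu, hη]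
    have eb : b = k + (k + 1) * z := by
      apply Complex.ext <;> simp [hb, hv, hη]
    simp only [hY, quad_zero, quad_one, quad_two, quad_three, ea, eb]
    linear_combination (k ^ 2 - 1 : ℂ) * hz
  obtain ⟨β, hβ⟩ : ∃ β, β = c.re * v + c.im * η := ⟨_, rfl⟩
  obtain ⟨α, hα⟩ : ∃ α, α = c.re * u + c.im * η := ⟨_, rfl⟩
  obtain ⟨ξ, hξ⟩ : ∃ ξ, ξ = c.re * (u * v - η ^ 2) + c.im * (η * (u + v)) := ⟨_, rfl⟩
  have j1 : β * u - ξ = -η * (c.im * v - c.re * η) := by rw [hβ, hξ]; ring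
  have j2 : α * v - ξ = -η * (c.im * u - c.re * η) := by rw [hα, hξ]; ring
  have j1' : β * u - ξ ≠ 0 := by
    rw [j1]; exact mul_ne_zero (neg_ne_zero.2 hη0) (fun e => ht4 (by linarith))
  have j2' : α * v - ξ ≠ 0 := by
    rw [j2]; exact mul_ne_zero (neg_ne_zero.2 hη0) (fun e => ht3 (by linarith))
  have j3 : β * u - α * v = c.im * η * (u - v) := by rw [hα, hβ]; ring
  have j3' : β * u - α * v ≠ 0 := by rw [j3]; positivity
  set p : ℝ → ZMod 4 → ℂ := fun r => quad ⟨r * ξ, η⟩ ⟨r * β * u, r * β * η⟩ ⟨r * ξ, k * η⟩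
    ⟨r * α * v, r * α * η⟩ with hp
  have k0 : ∀ r, cross (p r 1 - p r 0) (p r 2 - p r 1) = r * ((β * u - ξ) * η * (k - 1)) := by
    intro r; simp [hp, cross]; ring
  have k1 : ∀ r, cross (p r 2 - p r 1) (p r 3 - p r 2) =
      r * ((ξ - β * u) * (r * α * η - k * η) - (k * η - r * β * η) * (α * v - ξ)) := by
    intro r; simp [hp, cross]; ring
  have k2 : ∀ r, cross (p r 3 - p r 2) (p r 0 - p r 3) = r * ((α * v - ξ) * η * (1 - k)) := by
    intro r; simp [hp, cross]; ring
  have k3 : ∀ r, cross (p r 0 - p r 3) (p r 1 - p r 0) =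
      r * ((ξ - α * v) * (r * β * η - η) - (η - r * α * η) * (β * u - ξ)) := by
    intro r; simp [hp, cross]; ring
  have k4 : ∀ r, dot (p r 1 - p r 0) (p r 3 - p r 2) =
      r ^ 2 * (β * u - ξ) * (α * v - ξ) + (r * β * η - η) * (r * α * η - k * η) := by
    intro r; simp [hp, dot]; ring
  obtain ⟨r, hr, r1, r3, r4⟩ := (punctured.and <|
    (Continuous.eventually_ne_punctured (f := fun r =>
      (ξ - β * u) * (r * α * η - k * η) - (k * η - r * β * η) * (α * v - ξ)) (by fun_prop) (by
        intro e
        refine mul_ne_zero (mul_ne_zero hk0 hη0) j3' ?_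
        linear_combination e)).and <|
    (Continuous.eventually_ne_punctured (f := fun r =>
      (ξ - α * v) * (r * β * η - η) - (η - r * α * η) * (β * u - ξ)) (by fun_prop) (by
        intro e
        refine mul_ne_zero hη0 j3' ?_
        linear_combination -e)).and
    (Continuous.eventually_ne_punctured (f := fun r => dot (p r 1 - p r 0) (p r 3 - p r 2))
      (by simp only [k4]; fun_prop) (by simp [k4, hη0, hk0]))).exists
  refine ⟨Y, p r, hYnd, hYδ, ⟨⟨?_, ?_, ?_, ?_⟩, r * (conj c * a * b), 1, 0, one_ne_zero, ?_⟩,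
    Or.inl r4, r * (v - u) / (1 - k), ?_, ?_⟩
  · rw [k0]; exact mul_ne_zero hr (mul_ne_zero (mul_ne_zero j1' hη0) hk1)
  · rw [k1]; exact mul_ne_zero hr r1
  · rw [k2]; exact mul_ne_zero hr (mul_ne_zero (mul_ne_zero j2' hη0) (fun e => hk1 (by linarith)))
  · rw [k3]; exact mul_ne_zero hr r3
  · obtain ⟨s0, s1, s2, s3⟩ := hYnd.sides_ne
    simp only [one_mul, add_zero]
    refine forall_zmod_four.2 ⟨cfoot_eq_of s0 ?_ ?_, cfoot_eq_of s1 ?_ ?_, cfoot_eq_of s2 ?_ ?_,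
      cfoot_eq_of s3 ?_ ?_⟩
    · change cross (p r 0 - Y 0) (Y 1 - Y 0) = 0
      simp [hp, hY, cross, ha, hb]
    · change dot (p r 0 - _) (Y 1 - Y 0) = 0
      simp [hp, hY, dot, ha, hb, hξ]; left; ring
    · change cross (p r 1 - Y 1) (Y 2 - Y 1) = 0
      simp [hp, hY, cross, ha, hb]; ring
    · change dot (p r 1 - _) (Y 2 - Y 1) = 0
      simp [hp, hY, dot, ha, hb, hβ]; ring
    · change cross (p r 2 - Y 2) (Y 3 - Y 2) = 0
      simp [hp, hY, cross, ha, hb]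
    · change dot (p r 2 - _) (Y 3 - Y 2) = 0
      simp [hp, hY, dot, ha, hb, hξ]; left; ring
    · change cross (p r 3 - Y 3) (Y 0 - Y 3) = 0
      simp [hp, hY, cross, ha, hb]; ring
    · change dot (p r 3 - _) (Y 0 - Y 3) = 0
      simp [hp, hY, dot, ha, hb, hα]; ring
  · exact div_ne_zero (mul_ne_zero hr (fun e => huv (by linarith))) (fun e => hk1 (by linarith))
  · have hk1' : 1 - k ≠ 0 := fun e => hk1 (by linarith)
    have hq : r * (v - u) / (1 - k) * (1 - k) = r * (v - u) := by field_simp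
    generalize r * (v - u) / (1 - k) = ρ at hq
    apply Complex.ext
    · simp [hp, hα, hβ]; linear_combination (c.im * η) * hq
    · simp [hp, hα, hβ]; linear_combination (-c.re * η) * hq

/-- A quadrilateral with parallel diagonals is a pedal quadrilateral of a trapezoid. -/
lemma exists_step_of_parallel_diagonals {W : ZMod 4 → ℂ} (hW : Nondeg W)
    (h : cross (W 0 - W 2) (W 1 - W 3) = 0) :
    ∃ V, Nondeg V ∧ cross (V 0 - V 2) (V 1 - V 3) ≠ 0 ∧ Step V W := by
  have hl : W 2 - W 0 ≠ 0 := sub_ne_zero.2 hW.diagonal_ne.symm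
  have n0 := hW.1
  have n1 := hW.2.1
  obtain ⟨l, hl'⟩ : ∃ l, l = W 2 - W 0 := ⟨_, rfl⟩
  obtain ⟨z, hz⟩ : ∃ z, W 1 = W 0 + l * z := ⟨(W 1 - W 0) / l, by subst hl'; field_simp; ring⟩
  obtain ⟨w, hw⟩ : ∃ w, W 3 = W 0 + l * w := ⟨(W 3 - W 0) / l, by subst hl'; field_simp; ring⟩
  have h2 : W 2 = W 0 + l := by rw [hl']; ring
  rw [← hl'] at hl
  have hn := (Complex.normSq_pos.2 hl).ne'
  have hzw : w.im = z.im := by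
    have : cross (W 0 - W 2) (W 1 - W 3) = Complex.normSq l * (w.im - z.im) := by
      rw [h2, hz, hw]; simp [cross, Complex.normSq_apply]; ring
    rw [this] at h
    linarith [(mul_eq_zero.1 h).resolve_left hn]
  have hh : z.im ≠ 0 := by
    intro e; apply n0
    have : cross (W 1 - W 0) (W 2 - W 1) = -Complex.normSq l * z.im := by
      rw [h2, hz]; simp [cross, Complex.normSq_apply]; ring
    rw [this, e]; ring
  have hab : w.re - z.re ≠ 0 := by
    intro e; apply n1
    have : w = z := Complex.ext (by linarith) hzw
    rw [hz, hw, this]; simp only [cross, Complex.sub_re, Complex.sub_im]; ring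
  obtain ⟨a, ha⟩ : ∃ a, a = z.re := ⟨_, rfl⟩
  obtain ⟨b, hb⟩ : ∃ b, b = w.re := ⟨_, rfl⟩
  obtain ⟨η, hη⟩ : ∃ η, η = z.im := ⟨_, rfl⟩
  rw [← hη] at hzw hh
  rw [← ha, ← hb] at hab
  set V : ZMod 4 → ℂ := quad ⟨0, η - b * (a + 1) / η⟩ ⟨0, η - a * (b + 1) / η⟩
    ⟨1, η + (b + 1) * (1 - a) / η⟩ ⟨1, η + (a + 1) * (1 - b) / η⟩ with hV
  have hVn : Nondeg V := by
    refine ⟨?_, ?_, ?_, ?_⟩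
    · have : cross (V 1 - V 0) (V 2 - V 1) = -(b - a) / η := by
        simp [hV, cross]; field_simp; ring
      rw [this]; exact div_ne_zero (neg_ne_zero.2 hab) hh
    · have : cross (V 2 - V 1) (V 3 - V 2) = -2 * (b - a) / η := by
        simp [hV, cross]; field_simp; ring
      rw [this]; exact div_ne_zero (mul_ne_zero (by norm_num) hab) hh
    · have : cross (V 3 - V 2) (V 0 - V 3) = -2 * (b - a) / η := by
        simp [hV, cross]; field_simp; ring
      rw [this]; exact div_ne_zero (mul_ne_zero (by norm_num) hab) hh
    · have : cross (V 0 - V 3) (V 1 - V 0) = -(b - a) / η := by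
        simp [hV, cross]; field_simp; ring
      rw [this]; exact div_ne_zero (neg_ne_zero.2 hab) hh
  refine ⟨V, hVn, ?_, hW, (a + b + 1 : ℝ), l⁻¹, -(l⁻¹ * W 0), inv_ne_zero hl, ?_⟩
  · have : cross (V 0 - V 2) (V 1 - V 3) = -3 * (b - a) / η := by
      simp [hV, cross]; field_simp; ring
    rw [this]; exact div_ne_zero (mul_ne_zero (by norm_num) hab) hh
  · obtain ⟨s0, s1, s2, s3⟩ := hVn.sides_ne
    have t1 : l⁻¹ * W 1 + -(l⁻¹ * W 0) = z := by rw [hz]; field_simp; ring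
    have t2 : l⁻¹ * W 2 + -(l⁻¹ * W 0) = 1 := by rw [h2]; field_simp; ring
    have t3 : l⁻¹ * W 3 + -(l⁻¹ * W 0) = w := by rw [hw]; field_simp; ring
    refine forall_zmod_four.2 ⟨?_, ?_, ?_, ?_⟩
    · rw [add_neg_cancel]
      apply cfoot_eq_of s0
      · change cross (0 - V 0) (V 1 - V 0) = 0
        simp [hV, cross]
      · change dot (0 - _) (V 1 - V 0) = 0
        simp [hV, dot]
    · rw [t1]
      apply cfoot_eq_of s1
      · simp [hV, cross, ← ha, ← hη]; field_simp; ring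
      · simp [hV, dot, ← ha, ← hη]; field_simp; ring
    · rw [t2]
      apply cfoot_eq_of s2
      · simp [hV, cross]
      · simp [hV, dot]
    · rw [t3]
      apply cfoot_eq_of s3
      · simp [hV, cross, ← hb, hzw]; field_simp; ring
      · simp [hV, dot, ← hb, hzw]; field_simp; ring

lemma transGen_of_cross_diagonals_ne {V W : ZMod 4 → ℂ} (hV : Nondeg V) (hW : Nondeg W)
    (hd : cross (W 0 - W 2) (W 1 - W 3) ≠ 0) : Relation.TransGen Step V W := by
  obtain ⟨c, hc, hcW⟩ := exists_ratio hd
  obtain ⟨p, hVp, hpO, hpd⟩ := exists_step_generic hV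
  obtain ⟨δ, hδ, hδp⟩ := exists_ratio hpd
  obtain ⟨μ, -, hp⟩ := exists_hasState hVp.1 hpO hδ hδp
  obtain ⟨Y, q, hY, hYd, hYq, hqO, ρ, hρ, hqd⟩ := exists_step_trapezoid hp.im_ne hc
  obtain ⟨ν, hν, hq⟩ := exists_hasState hYq.1 hqO (by simpa using ⟨hρ, hc⟩) hqd
  obtain ⟨τ, hτ⟩ : ∃ τ, τ = ν * ρ := ⟨_, rfl⟩
  have hτ0 : τ ≠ 0 := hτ ▸ mul_ne_zero hν hρ
  rw [show (ν : ℂ) * (ρ * c) = τ * c by rw [hτ]; push_cast; ring] at hq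
  obtain ⟨r, hr, hrτ⟩ : ∃ r : ℝ, 0 < r ∧ r * τ * Complex.normSq c ≠ -1 := by
    by_cases h : 1 * τ * Complex.normSq c = -1
    · exact ⟨2, two_pos, fun e => by linarith⟩
    · exact ⟨1, one_pos, h⟩
  obtain ⟨Y₁, hY₁d, hY₁⟩ := exists_hasState_smul hq.im_ne hr.ne'
    (by nlinarith [mul_nonneg hr.le (Complex.normSq_nonneg (τ * c))])
  have hrτ0 : r * τ ≠ 0 := mul_ne_zero hr.ne' hτ0
  obtain ⟨Y₂, hY₂d, hY₂⟩ := exists_hasState_smul hY₁.im_ne (inv_ne_zero hrτ0) (by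
    rw [← mul_assoc, ← Complex.ofReal_mul, Complex.normSq_mul, Complex.normSq_ofReal]
    convert hrτ using 1
    field_simp)
  have e : ((r * τ)⁻¹ : ℝ) * (r * (τ * c)) = c := by
    rw [← mul_assoc (r : ℂ), ← Complex.ofReal_mul, ← mul_assoc, ← Complex.ofReal_mul,
      inv_mul_cancel₀ hrτ0, Complex.ofReal_one, one_mul]
  rw [e] at hY₂
  exact ((((Relation.TransGen.single hVp).trans (hp.transGen hY hYd)).tail hYq).trans
    (hq.transGen hY₁.nondeg hY₁d)).trans
    ((hY₁.transGen hY₂.nondeg hY₂d).trans (hY₂.transGen hW hcW))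

lemma transGen_step {V W : ZMod 4 → ℂ} (hV : Nondeg V) (hW : Nondeg W) :
    Relation.TransGen Step V W := by
  by_cases hd : cross (W 0 - W 2) (W 1 - W 3) = 0
  · obtain ⟨U, hU, hUd, hUW⟩ := exists_step_of_parallel_diagonals hW hd
    exact (transGen_of_cross_diagonals_ne hV hU hUd).tail hUW
  · exact transGen_of_cross_diagonals_ne hV hW hd

lemma cross_mul_mul (l z w : ℂ) : cross (l * z) (l * w) = Complex.normSq l * cross z w := by
  simp [cross, Complex.normSq_apply]; ring

lemma dot_mul_mul (l z w : ℂ) : dot (l * z) (l * w) = Complex.normSq l * dot z w := by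
  simp [dot, Complex.normSq_apply]; ring

lemma cfoot_affine {l : ℂ} (hl : l ≠ 0) (m A B X : ℂ) :
    cfoot (l * A + m) (l * B + m) (l * X + m) = l * cfoot A B X + m := by
  have h : ∀ z w : ℂ, l * z + m - (l * w + m) = l * (z - w) := fun z w => by ring
  rw [cfoot, cfoot, h, h, dot_mul_mul, dot_mul_mul,
    mul_div_mul_left _ _ (Complex.normSq_pos.2 hl).ne']
  ring

lemma Nondeg.affine {V : ZMod 4 → ℂ} (h : Nondeg V) {l : ℂ} (hl : l ≠ 0) (m : ℂ) :
    Nondeg fun i => l * V i + m := by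
  have hn := (Complex.normSq_pos.2 hl).ne'
  have e : ∀ z w : ℂ, l * z + m - (l * w + m) = l * (z - w) := fun z w => by ring
  obtain ⟨h0, h1, h2, h3⟩ := h
  simp only [Nondeg, e, cross_mul_mul]
  exact ⟨mul_ne_zero hn h0, mul_ne_zero hn h1, mul_ne_zero hn h2, mul_ne_zero hn h3⟩

/-- The identification of the Euclidean plane with the complex numbers. -/
def toComplex : Plane ≃ₗᵢ[ℝ] ℂ := Complex.orthonormalBasisOneI.repr.symm

lemma dot_toComplex (v w : Plane) : dot (toComplex v) (toComplex w) = ⟪v, w⟫_ℝ := by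
  rw [← toComplex.inner_map_map, Complex.inner]
  simp [dot]
  ring

lemma toComplex_foot (A B X : Plane) :
    toComplex (foot A B X) = cfoot (toComplex A) (toComplex B) (toComplex X) := by
  simp only [foot, cfoot, ← map_sub, dot_toComplex, map_add, map_smul, Complex.real_smul]

lemma exists_smul_of_cross_eq_zero {z w : ℂ} (hz : z ≠ 0) (h : cross z w = 0) :
    ∃ r : ℝ, w = r * z := by
  have hn := (dot_self_pos hz).ne'
  refine ⟨dot z w / dot z z, ?_⟩
  have hr : dot z w / dot z z * dot z z = dot z w := by field_simp
  generalize dot z w / dot z z = r at hr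
  simp only [cross, dot] at *
  apply Complex.ext <;> apply mul_left_cancel₀ hn <;>
    simp only [Complex.re_ofReal_mul, Complex.im_ofReal_mul]
  · linear_combination -z.re * hr - z.im * h
  · linear_combination -z.im * hr + z.re * h

lemma collinear_iff_cross (A B C : Plane) :
    Collinear ℝ ({A, B, C} : Set Plane) ↔
      cross (toComplex B - toComplex A) (toComplex C - toComplex B) = 0 := by
  constructor
  · intro h
    obtain ⟨v, hv⟩ := (collinear_iff_of_mem (p₀ := A) (by simp)).1 h
    obtain ⟨s, hs⟩ := hv B (by simp)
    obtain ⟨t, ht⟩ := hv C (by simp)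
    rw [hs, ht]
    simp [cross]
    ring
  · intro h
    by_cases e : A = B
    · subst e; simpa using collinear_pair ℝ A C
    · have hz : toComplex B - toComplex A ≠ 0 :=
        sub_ne_zero.2 fun e' => e (toComplex.injective e'.symm)
      obtain ⟨r, hr⟩ := exists_smul_of_cross_eq_zero hz h
      refine (collinear_iff_of_mem (p₀ := A) (by simp)).2 ⟨B - A, ?_⟩
      rintro p (rfl | rfl | rfl)
      · exact ⟨0, by simp⟩
      · exact ⟨1, by simp⟩
      · refine ⟨r + 1, toComplex.injective ?_⟩
        simp only [vadd_eq_add, map_add, map_smul, map_sub, Complex.real_smul]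
        push_cast
        linear_combination hr

lemma noThreeCollinear_iff (V : ZMod 4 → Plane) :
    NoThreeCollinear V ↔ Nondeg (toComplex ∘ V) := by
  simp only [NoThreeCollinear, collinear_iff_cross, forall_zmod_four]
  rfl

lemma pedalSeq_congr {n : ℕ} (V : ZMod n → Plane) {X X' : ℕ → Plane} {m : ℕ}
    (h : ∀ k ≤ m, X k = X' k) : pedalSeq V X m = pedalSeq V X' m := by
  induction m with
  | zero => rfl
  | succ m ih => rw [pedalSeq, pedalSeq, ih fun k hk => h k (hk.trans m.le_succ), h _ le_rfl]

lemma exists_pedal_of_step {P : ZMod 4 → Plane} {U W : ZMod 4 → ℂ} {l m : ℂ} (hl : l ≠ 0)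
    (hP : ∀ i, toComplex (P i) = l * U i + m) (h : Step U W) :
    ∃ X, NoThreeCollinear (pedal P X) ∧
      ∃ l' m' : ℂ, l' ≠ 0 ∧ ∀ i, toComplex (pedal P X i) = l' * W i + m' := by
  obtain ⟨hW, X, a, b, ha, hX⟩ := h
  have key : ∀ i, toComplex (pedal P (toComplex.symm (l * X + m)) i) =
      l * a * W i + (l * b + m) := by
    intro i
    rw [pedal, toComplex_foot, hP, hP, LinearIsometryEquiv.apply_symm_apply, cfoot_affine hl, hX]
    ring
  refine ⟨_, (noThreeCollinear_iff _).2 ?_, _, _, mul_ne_zero hl ha, key⟩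
  rw [show toComplex ∘ pedal P _ = _ from funext key]
  exact hW.affine (mul_ne_zero hl ha) _

lemma exists_pedalSeq_of_transGen {V : ZMod 4 → Plane} {U : ZMod 4 → ℂ}
    (h : Relation.TransGen Step (toComplex ∘ V) U) :
    ∃ m : ℕ, 1 ≤ m ∧ ∃ X : ℕ → Plane,
      (∀ k : ℕ, 1 ≤ k → k ≤ m → NoThreeCollinear (pedalSeq V X k)) ∧
      ∃ l b : ℂ, l ≠ 0 ∧ ∀ i, toComplex (pedalSeq V X m i) = l * U i + b := by
  induction h with
  | single h =>
    obtain ⟨X, h1, h2⟩ := exists_pedal_of_step (P := V) (m := 0) one_ne_zero (by simp) h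
    refine ⟨1, le_rfl, fun _ => X, fun k hk hk' => ?_, h2⟩
    obtain rfl : k = 1 := le_antisymm hk' hk
    exact h1
  | tail _ h ih =>
    obtain ⟨m, hm, X, hX, l, b, hl, hb⟩ := ih
    obtain ⟨Z, h1, h2⟩ := exists_pedal_of_step hl hb h
    have old : ∀ k ≤ m, pedalSeq V (Function.update X (m + 1) Z) k = pedalSeq V X k :=
      fun k hk => pedalSeq_congr V fun j hj => Function.update_of_ne (by omega) _ _
    have new : pedalSeq V (Function.update X (m + 1) Z) (m + 1) = pedal (pedalSeq V X m) Z := by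
      rw [pedalSeq, old m le_rfl, Function.update_self]
    refine ⟨m + 1, by omega, Function.update X (m + 1) Z, fun k hk hk' => ?_, new ▸ h2⟩
    rcases hk'.lt_or_eq with hlt | rfl
    · rw [old k (by omega)]
      exact hX k hk (by omega)
    · rwa [new]

lemma pedalEquiv_of_noThreeCollinear {V W : ZMod 4 → Plane} (hV : NoThreeCollinear V)
    (hW : NoThreeCollinear W) : PedalEquiv V W := by
  obtain ⟨m, hm, X, hX, l, b, hl, hb⟩ := exists_pedalSeq_of_transGen
    (transGen_step ((noThreeCollinear_iff V).1 hV) ((noThreeCollinear_iff W).1 hW))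
  refine ⟨m, hm, X, hX, ‖l‖, norm_pos_iff.2 hl, 0, Or.inl fun i j => ?_⟩
  rw [zero_add, zero_add, ← toComplex.dist_map, ← toComplex.dist_map (W i), hb, hb, dist_eq_norm,
    dist_eq_norm, add_sub_add_right_eq_sub, ← mul_sub, norm_mul]
  rfl

/-- **Any two quadrilaterals are pedal equivalent**: if no three successive vertices of
`V` or of `W` are collinear and the opposite vertices of each are distinct, then
`V ⊥ W`; consequently the quotient of this set of quadrilaterals by pedal equivalence
has exactly one element. -/
theorem quadrilaterals_pedalEquiv
    (V W : ZMod 4 → Plane)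
    (hV : NoThreeCollinear V) (hW : NoThreeCollinear W)
    (hV13 : V 0 ≠ V 2) (hV24 : V 1 ≠ V 3)
    (hW13 : W 0 ≠ W 2) (hW24 : W 1 ≠ W 3) :
    PedalEquiv V W ∧
    Nonempty (Quot fun A B : Quad4 => PedalEquiv A.1 B.1) ∧
    ∀ a b : Quot fun A B : Quad4 => PedalEquiv A.1 B.1, a = b := by
  refine ⟨pedalEquiv_of_noThreeCollinear hV hW, ⟨Quot.mk _ ⟨V, hV, hV13, hV24⟩⟩, ?_⟩
  rintro ⟨A⟩ ⟨B⟩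
  exact Quot.sound (pedalEquiv_of_noThreeCollinear A.2.1 B.2.1)
end
end

section
/- Let V = (V_1,V_2,V_3,V_4) be a square in ℝ². Then for every point X ∈ ℝ², the pedal quadrilateral P = 𝒫(V,X) has orthogonal diagonals: ⟨P_1 − P_3, P_2 − P_4⟩ = 0. -/
open scoped InnerProductSpace

noncomputable section

/-- A rectangle: a 4-gon with nonzero, pairwise-orthogonal consecutive edge vectors. -/
def IsRectangle (R : ZMod 4 → Plane) : Prop :=
  ∀ i : ZMod 4, R (i + 1) ≠ R i ∧ ⟪R (i + 1) - R i, R (i + 2) - R (i + 1)⟫_ℝ = 0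

/-- A square: a rectangle all of whose sides have the same length. -/
def IsSquareGon (V : ZMod 4 → Plane) : Prop :=
  IsRectangle V ∧ ∀ i j : ZMod 4, dist (V i) (V (i + 1)) = dist (V j) (V (j + 1))

/-- The feet of the perpendiculars from a point to two opposite sides of a rectangle differ by
the edge vector joining these sides. -/
theorem foot_sub_foot_of_rectangle {A B C D : Plane} (hAB : B ≠ A) (hpar : D - C = -(B - A))
    (horth : ⟪B - A, C - B⟫_ℝ = 0) (X : Plane) : foot A B X - foot C D X = B - C := by
  have hne : ⟪B - A, B - A⟫_ℝ ≠ 0 := inner_self_ne_zero.mpr (sub_ne_zero.mpr hAB)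
  have hinner : ⟪X - C, B - A⟫_ℝ = ⟪X - A, B - A⟫_ℝ - ⟪B - A, B - A⟫_ℝ := by
    rw [show X - C = X - A - (B - A) - (C - B) by abel, inner_sub_left, inner_sub_left,
      real_inner_comm (B - A) (C - B), horth, sub_zero]
  unfold foot
  rw [hpar, inner_neg_neg, inner_neg_right, hinner, neg_div, sub_div, div_self hne]
  module

/-- Opposite edge vectors of a 4-gon with orthogonal consecutive edges are opposite. -/
theorem IsRectangle.sub_eq_neg_sub {R : ZMod 4 → Plane} (hR : IsRectangle R) (i : ZMod 4) :
    R (i + 3) - R (i + 2) = -(R (i + 1) - R i) := by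
  have h0 := (hR i).2
  have h1 := (hR (i + 1)).2
  have h2 := (hR (i + 2)).2
  have h3 := (hR (i + 3)).2
  simp only [add_assoc] at h1 h2 h3
  rw [show (1 : ZMod 4) + 1 = 2 from rfl, show (1 : ZMod 4) + 2 = 3 from rfl] at h1
  rw [show (2 : ZMod 4) + 1 = 3 from rfl, show (2 : ZMod 4) + 2 = 0 from rfl, add_zero] at h2
  rw [show (3 : ZMod 4) + 1 = 0 from rfl, show (3 : ZMod 4) + 2 = 1 from rfl, add_zero] at h3
  rw [eq_neg_iff_add_eq_zero, ← inner_self_eq_zero (𝕜 := ℝ)]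
  nth_rewrite 2 [show R (i + 3) - R (i + 2) + (R (i + 1) - R i) =
    -((R (i + 2) - R (i + 1)) + (R i - R (i + 3))) by abel]
  rw [inner_neg_right, inner_add_left, inner_add_right, inner_add_right, h0, h2,
    real_inner_comm, h1, real_inner_comm, h3]
  simp

/-- **Pedal quadrilaterals of a square have orthogonal diagonals**: for every square
`V` and every point `X`, the pedal quadrilateral `P = 𝒫(V,X)` satisfies
`⟪P₁ - P₃, P₂ - P₄⟫ = 0`. -/
theorem square_pedal_orthogonal_diagonals
    (V : ZMod 4 → Plane) (hV : IsSquareGon V) (X : Plane) :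
    ⟪pedal V X 0 - pedal V X 2, pedal V X 1 - pedal V X 3⟫_ℝ = 0 := by
  have h02 : pedal V X 0 - pedal V X 2 = V 1 - V 2 :=
    foot_sub_foot_of_rectangle (hV.1 0).1 (hV.1.sub_eq_neg_sub 0) (hV.1 0).2 X
  have h13 : pedal V X 1 - pedal V X 3 = V 2 - V 3 :=
    foot_sub_foot_of_rectangle (hV.1 1).1 (hV.1.sub_eq_neg_sub 1) (hV.1 1).2 X
  have horth : ⟪V 2 - V 1, V 3 - V 2⟫_ℝ = 0 := (hV.1 1).2
  rw [h02, h13, ← neg_sub (V 2) (V 1), ← neg_sub (V 3) (V 2), inner_neg_neg, horth]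
end
end
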